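/- arXiv:1309.1007 — 3 statements merged into one kernel-verified Lean document; each statement's English description precedes it below -/
import Mathlib

section
/- Let X = ℝ with the metric ρ(x, x') = |x − x'| and μ the standard Gaussian measure N(0,1). Then the symmetrized distance Ξ(X) satisfies E[e^{λ Ξ(X)}] = e^{λ²} for all λ ∈ ℝ, and consequently the subgaussian diameter of this (unbounded-diameter) space is Δ_SG(X) = √2. -/
open MeasureTheory Real
open scoped ENNReal

/-- The moment generating function of the symmetrized distance `Ξ(X) = ε·ρ(Y,Y')`,
where `Y, Y' ~ μ` are independent and `ε` is an independent uniform sign: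
`E[e^{λΞ}] = E[(e^{λρ(Y,Y')} + e^{-λρ(Y,Y')})/2]`. -/
noncomputable def mgfXi {X : Type*} [PseudoMetricSpace X] [MeasurableSpace X]
    (μ : Measure X) (l : ℝ) : ℝ≥0∞ :=
  ∫⁻ y, ∫⁻ y', ENNReal.ofReal
    ((Real.exp (l * dist y y') + Real.exp (-(l * dist y y'))) / 2) ∂μ ∂μ

/-- The subgaussian diameter `Δ_SG(X) = σ*(Ξ(X))`: the smallest `σ ≥ 0` such that
`E[e^{λΞ}] ≤ e^{σ²λ²/2}` for all `λ`. -/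
noncomputable def subgDiam {X : Type*} [PseudoMetricSpace X] [MeasurableSpace X]
    (μ : Measure X) : ℝ :=
  sInf {σ : ℝ | 0 ≤ σ ∧ ∀ l : ℝ, mgfXi μ l ≤ ENNReal.ofReal (Real.exp (σ ^ 2 * l ^ 2 / 2))}

theorem lintegral_exp_mul_gaussianReal (l : ℝ) :
    ∫⁻ x, ENNReal.ofReal (Real.exp (l * x)) ∂(ProbabilityTheory.gaussianReal 0 1)
      = ENNReal.ofReal (Real.exp (l ^ 2 / 2)) := by
  rw [← ofReal_integral_eq_lintegral_ofReal
    (ProbabilityTheory.integrable_exp_mul_gaussianReal l) (ae_of_all _ fun _ => by positivity)]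
  have h := congrFun (ProbabilityTheory.mgf_id_gaussianReal (μ := 0) (v := 1)) l
  simp only [ProbabilityTheory.mgf, id, zero_mul, zero_add, NNReal.coe_one, one_mul] at h
  rw [h]

theorem exp_mul_dist_add_exp_neg_mul_dist (l x y : ℝ) :
    Real.exp (l * dist x y) + Real.exp (-(l * dist x y))
      = Real.exp (l * x) * Real.exp (-l * y) + Real.exp (-l * x) * Real.exp (l * y) := by
  rw [Real.dist_eq, ← Real.exp_add, ← Real.exp_add]
  rcases abs_cases (x - y) with ⟨h, -⟩ | ⟨h, -⟩ <;> rw [h]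
  · ring_nf
  · rw [add_comm]
    ring_nf

theorem mgfXi_gaussianReal (l : ℝ) :
    mgfXi (ProbabilityTheory.gaussianReal 0 1) l = ENNReal.ofReal (Real.exp (l ^ 2)) := by
  have key (x y : ℝ) : ENNReal.ofReal
      ((Real.exp (l * dist x y) + Real.exp (-(l * dist x y))) / 2)
      = (ENNReal.ofReal (Real.exp (l * x)) * ENNReal.ofReal (Real.exp (-l * y))
        + ENNReal.ofReal (Real.exp (-l * x)) * ENNReal.ofReal (Real.exp (l * y))) / 2 := by
    rw [exp_mul_dist_add_exp_neg_mul_dist, ENNReal.ofReal_div_of_pos two_pos,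
      ENNReal.ofReal_add (by positivity) (by positivity), ENNReal.ofReal_mul (by positivity),
      ENNReal.ofReal_mul (by positivity), ENNReal.ofReal_ofNat]
  simp only [mgfXi, key, div_eq_mul_inv _ (2 : ℝ≥0∞)]
  have hinner (x : ℝ) :
      ∫⁻ y, (ENNReal.ofReal (Real.exp (l * x)) * ENNReal.ofReal (Real.exp (-l * y))
        + ENNReal.ofReal (Real.exp (-l * x)) * ENNReal.ofReal (Real.exp (l * y))) * 2⁻¹
        ∂(ProbabilityTheory.gaussianReal 0 1)
      = (ENNReal.ofReal (Real.exp (l * x)) + ENNReal.ofReal (Real.exp (-l * x)))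
        * (ENNReal.ofReal (Real.exp (l ^ 2 / 2)) * 2⁻¹) := by
    rw [lintegral_mul_const _ (by fun_prop), lintegral_add_left (by fun_prop),
      lintegral_const_mul _ (by fun_prop), lintegral_const_mul _ (by fun_prop),
      lintegral_exp_mul_gaussianReal, lintegral_exp_mul_gaussianReal, neg_sq, ← add_mul, mul_assoc]
  simp only [hinner]
  rw [lintegral_mul_const _ (by fun_prop), lintegral_add_left (by fun_prop),
    lintegral_exp_mul_gaussianReal, lintegral_exp_mul_gaussianReal, neg_sq, ← two_mul,
    mul_comm (2 : ℝ≥0∞), mul_mul_mul_comm,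
    ENNReal.mul_inv_cancel two_ne_zero ENNReal.ofNat_ne_top, mul_one,
    ← ENNReal.ofReal_mul (by positivity), ← Real.exp_add, add_halves]

/-- For `X = ℝ` with `ρ(x,x') = |x - x'|` and `μ` the standard Gaussian measure `N(0,1)`,
the symmetrized distance satisfies `E[e^{λΞ}] = e^{λ²}` for all `λ`, and consequently the
subgaussian diameter of this (unbounded-diameter) space equals `√2`. -/
theorem subgDiam_gaussian :
    (∀ l : ℝ, mgfXi (ProbabilityTheory.gaussianReal 0 1) l = ENNReal.ofReal (Real.exp (l ^ 2)))
      ∧ subgDiam (ProbabilityTheory.gaussianReal 0 1) = Real.sqrt 2 := by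
  refine ⟨mgfXi_gaussianReal, ?_⟩
  have hset : {σ : ℝ | 0 ≤ σ ∧ ∀ l : ℝ, mgfXi (ProbabilityTheory.gaussianReal 0 1) l
      ≤ ENNReal.ofReal (Real.exp (σ ^ 2 * l ^ 2 / 2))} = Set.Ici (Real.sqrt 2) := by
    ext σ
    simp only [mgfXi_gaussianReal, ENNReal.ofReal_le_ofReal_iff (Real.exp_pos _).le,
      Real.exp_le_exp, Set.mem_ofPred_eq, Set.mem_Ici]
    refine ⟨fun ⟨h0, h⟩ => Real.sqrt_le_iff.2 ⟨h0, by linarith [h 1]⟩, fun h => ?_⟩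
    obtain ⟨h0, h2⟩ := Real.sqrt_le_iff.1 h
    exact ⟨h0, fun l => by nlinarith [sq_nonneg l]⟩
  rw [subgDiam, hset, csInf_Ici]
end

section
/- Let (X, ρ, μ) be a metric probability space with Δ_SG(X) < ∞ and let F : X → ℝ be 1-Lipschitz with respect to ρ. Then for all λ ∈ ℝ, if Y, Y' ~ μ are independent, E[e^{λ(F(Y) − F(Y'))}] ≤ E[e^{λ Ξ(X)}] ≤ exp(λ² Δ_SG(X)² / 2). -/
open MeasureTheory Real
open scoped ENNReal

/-- Swapping two independent copies: the exponential moment of `f(Y) - f(Y')` equals the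
corresponding hyperbolic cosine moment. -/
theorem lintegral_exp_sub_eq_lintegral_cosh_sub {X : Type*} [MeasurableSpace X] (μ : Measure X)
    [SFinite μ] {f : X → ℝ} (hf : Measurable f) :
    ∫⁻ y, ∫⁻ y', ENNReal.ofReal (Real.exp (f y - f y')) ∂μ ∂μ =
      ∫⁻ y, ∫⁻ y', ENNReal.ofReal (Real.cosh (f y - f y')) ∂μ ∂μ := by
  set g : X × X → ℝ≥0∞ := fun p ↦ ENNReal.ofReal (Real.exp (f p.1 - f p.2)) with hg
  have hgm : Measurable g := by fun_prop
  have hcosh (y y' : X) :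
      ENNReal.ofReal (Real.cosh (f y - f y')) = 2⁻¹ * (g (y, y') + g (y', y)) := by
    rw [hg, ← ENNReal.ofReal_add (exp_pos _).le (exp_pos _).le, Real.cosh_eq, neg_sub,
      div_eq_inv_mul, ENNReal.ofReal_mul (by norm_num), ENNReal.ofReal_inv_of_pos (by norm_num),
      ENNReal.ofReal_ofNat]
  have hswap : ∫⁻ y, ∫⁻ y', g (y', y) ∂μ ∂μ = ∫⁻ y, ∫⁻ y', g (y, y') ∂μ ∂μ :=
    lintegral_lintegral_swap (f := fun y y' ↦ g (y', y)) (by fun_prop)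
  have hinner (y : X) : ∫⁻ y', 2⁻¹ * (g (y, y') + g (y', y)) ∂μ =
      2⁻¹ * (∫⁻ y', g (y, y') ∂μ + ∫⁻ y', g (y', y) ∂μ) := by
    rw [lintegral_const_mul _ (by fun_prop), lintegral_add_left (by fun_prop)]
  have hleft : Measurable fun y ↦ ∫⁻ y', g (y, y') ∂μ := hgm.lintegral_prod_right'
  have hright : Measurable fun y ↦ ∫⁻ y', g (y', y) ∂μ := hgm.lintegral_prod_left'
  simp_rw [hcosh, hinner]
  rw [lintegral_const_mul _ (by fun_prop), lintegral_add_left hleft, hswap, ← two_mul,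
    ← mul_assoc, ENNReal.inv_mul_cancel (by norm_num) (by norm_num), one_mul]

/-- The exponential symmetrization inequality for `1`-Lipschitz functions. -/
theorem lintegral_exp_sub_le_mgfXi {X : Type*} [PseudoMetricSpace X] [MeasurableSpace X]
    [OpensMeasurableSpace X] (μ : Measure X) [SFinite μ] {F : X → ℝ} (hF : LipschitzWith 1 F)
    (l : ℝ) :
    ∫⁻ y, ∫⁻ y', ENNReal.ofReal (Real.exp (l * (F y - F y'))) ∂μ ∂μ ≤ mgfXi μ l := by
  have hFm : Measurable fun y ↦ l * F y := hF.continuous.measurable.const_mul l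
  simp_rw [mul_sub]
  rw [lintegral_exp_sub_eq_lintegral_cosh_sub μ hFm, mgfXi]
  gcongr with y y'
  rw [← Real.cosh_eq, Real.cosh_le_cosh, ← mul_sub, abs_mul, abs_mul, abs_of_nonneg dist_nonneg]
  gcongr
  simpa [Real.dist_eq] using hF.dist_le_mul _ _

/-- The infimum defining the subgaussian diameter is attained when it is finite. -/
theorem mgfXi_le_exp_subgDiam {X : Type*} [PseudoMetricSpace X] [MeasurableSpace X]
    {μ : Measure X}
    (hfin : ∃ σ : ℝ, 0 ≤ σ ∧
      ∀ l : ℝ, mgfXi μ l ≤ ENNReal.ofReal (Real.exp (σ ^ 2 * l ^ 2 / 2))) (l : ℝ) :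
    mgfXi μ l ≤ ENNReal.ofReal (Real.exp (subgDiam μ ^ 2 * l ^ 2 / 2)) := by
  have hclosed : IsClosed {σ : ℝ | 0 ≤ σ ∧
      ∀ l : ℝ, mgfXi μ l ≤ ENNReal.ofReal (Real.exp (σ ^ 2 * l ^ 2 / 2))} := by
    simp only [Set.ofPred_and, Set.ofPred_forall]
    refine isClosed_Ici.inter (isClosed_iInter fun l ↦ isClosed_le continuous_const ?_)
    exact ENNReal.continuous_ofReal.comp (by fun_prop)
  exact (hclosed.csInf_mem hfin ⟨0, fun σ hσ ↦ hσ.1⟩).2 l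

/-- Let `(X, ρ, μ)` be a metric probability space with `Δ_SG(X) < ∞` and let `F : X → ℝ` be
`1`-Lipschitz.  Then for every `λ ∈ ℝ`, with `Y, Y' ~ μ` independent,
`E[e^{λ(F(Y) - F(Y'))}] ≤ E[e^{λΞ(X)}] ≤ exp(λ² Δ_SG(X)² / 2)`. -/
theorem symmetrization_mgf_bound {X : Type*} [MetricSpace X] [MeasurableSpace X] [BorelSpace X]
    (μ : Measure X) [IsProbabilityMeasure μ]
    (hfin : ∃ σ : ℝ, 0 ≤ σ ∧
      ∀ l : ℝ, mgfXi μ l ≤ ENNReal.ofReal (Real.exp (σ ^ 2 * l ^ 2 / 2)))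
    (F : X → ℝ) (hF : LipschitzWith 1 F) (l : ℝ) :
    (∫⁻ y, ∫⁻ y', ENNReal.ofReal (Real.exp (l * (F y - F y'))) ∂μ ∂μ) ≤ mgfXi μ l ∧
      mgfXi μ l ≤ ENNReal.ofReal (Real.exp (l ^ 2 * (subgDiam μ) ^ 2 / 2)) := by
  refine ⟨lintegral_exp_sub_le_mgfXi μ hF l, ?_⟩
  rw [mul_comm (l ^ 2)]
  exact mgfXi_le_exp_subgDiam hfin l
end

section
/- Let (Z, ρ, μ) be a metric probability space and let g : Z^n × Z → [0, ∞) be symmetric and β-totally-Lipschitz stable. Then the excess risk function φ : Z^n → ℝ given by φ(z) = R(z) − R̂_n(z) = E_{z̃ ~ μ}[g(z, z̃)] − (1/n) Σ_{i=1}^n g(z, z_i) is 3β-Lipschitz with respect to the ℓ1 product metric on Z^n. -/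
open MeasureTheory Real
open scoped ENNReal

/-- The excess risk function of totally Lipschitz stable algorithms is Lipschitz.
Let `(Z, ρ, μ)` be a metric probability space and let `g : Z^n × Z → [0, ∞)` be a measurable
loss map that is symmetric in the sample coordinates and `β`-totally-Lipschitz stable, i.e.
`(z_1, …, z_{n+1}) ↦ g((z_1, …, z_n), z_{n+1})` is `β`-Lipschitz for the `ℓ₁` product metric
on `Z^{n+1}`.  Then the excess risk `φ(z) = E_{z̃~μ}[g(z, z̃)] - (1/n) Σ_i g(z, z_i)` is
`3β`-Lipschitz with respect to the `ℓ₁` product metric on `Z^n`. -/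
theorem excess_risk_lipschitz {Z : Type*} [MetricSpace Z] [MeasurableSpace Z] [BorelSpace Z]
    (μ : Measure Z) [IsProbabilityMeasure μ] {n : ℕ}
    (g : (Fin n → Z) × Z → ℝ) (hmeas : Measurable g) (hnonneg : ∀ p, 0 ≤ g p)
    (hint : ∀ S : Fin n → Z, Integrable (fun z => g (S, z)) μ)
    (hsym : ∀ (e : Equiv.Perm (Fin n)) (S : Fin n → Z) (z : Z), g (S ∘ e, z) = g (S, z))
    (β : ℝ)
    (hstab : ∀ (S S' : Fin n → Z) (z z' : Z),
      |g (S, z) - g (S', z')| ≤ β * ((∑ i, dist (S i) (S' i)) + dist z z')) :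
    ∀ S S' : Fin n → Z,
      |((∫ z, g (S, z) ∂μ) - (1 / (n : ℝ)) * ∑ i, g (S, S i)) -
          ((∫ z, g (S', z) ∂μ) - (1 / (n : ℝ)) * ∑ i, g (S', S' i))|
        ≤ 3 * β * ∑ i, dist (S i) (S' i) := by
  intro S S'
  obtain ⟨z₀⟩ : Nonempty Z := nonempty_of_isProbabilityMeasure μ
  set D := ∑ i, dist (S i) (S' i) with hD
  have hpt : ∀ z, |g (S, z) - g (S', z)| ≤ β * D := fun z => by
    simpa using hstab S S' z z
  have hβD : 0 ≤ β * D := (abs_nonneg _).trans (hpt z₀)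
  have hrisk : |(∫ z, g (S, z) ∂μ) - ∫ z, g (S', z) ∂μ| ≤ β * D := by
    rw [← integral_sub (hint S) (hint S')]
    simpa using norm_integral_le_of_norm_le_const (μ := μ)
      (f := fun z => g (S, z) - g (S', z)) (Filter.Eventually.of_forall hpt)
  have hsum : |∑ i, g (S, S i) - ∑ i, g (S', S' i)| ≤ n * (β * D) + β * D := by
    rw [← Finset.sum_sub_distrib]
    calc |∑ i, (g (S, S i) - g (S', S' i))|
        ≤ ∑ i, |g (S, S i) - g (S', S' i)| := Finset.abs_sum_le_sum_abs _ _
      _ ≤ ∑ i, β * (D + dist (S i) (S' i)) :=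
          Finset.sum_le_sum fun i _ => hstab S S' (S i) (S' i)
      _ = n * (β * D) + β * D := by
          rw [← Finset.mul_sum, Finset.sum_add_distrib, ← hD]
          simp
          ring
  have hemp : |1 / (n : ℝ) * ∑ i, g (S, S i) - 1 / (n : ℝ) * ∑ i, g (S', S' i)|
      ≤ 2 * (β * D) := by
    rcases Nat.eq_zero_or_pos n with rfl | hn
    · simpa using hβD
    · have hn' : (1 : ℝ) ≤ n := by exact_mod_cast hn
      rw [← mul_sub, abs_mul, abs_of_nonneg (by positivity), one_div_mul_eq_div,
        div_le_iff₀ (by positivity)]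
      nlinarith
  calc |((∫ z, g (S, z) ∂μ) - 1 / (n : ℝ) * ∑ i, g (S, S i)) -
          ((∫ z, g (S', z) ∂μ) - 1 / (n : ℝ) * ∑ i, g (S', S' i))|
      = |((∫ z, g (S, z) ∂μ) - ∫ z, g (S', z) ∂μ) -
          (1 / (n : ℝ) * ∑ i, g (S, S i) - 1 / (n : ℝ) * ∑ i, g (S', S' i))| := by
        rw [sub_sub_sub_comm]
    _ ≤ β * D + 2 * (β * D) := (abs_sub _ _).trans (add_le_add hrisk hemp)
    _ = 3 * β * D := by ring
end
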